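/- Let n ≥ 2, 1 < p < ∞, 0 < q ≤ ∞, s < 0, and set r = min(q,1). There exists a constant C > 0 such that for every Schwartz function f ∈ 𝒮(ℝⁿ), ‖Tr f‖_{B^{s}_{p,q}(ℝ^{n−1})} ≤ C ( Σ_{k≥0} [ 2^{kr/p} a_k(f)^r + 2^{k(s+1/p)r} b_k(f)^r ] )^{1/r}. -/

import Mathlib

open MeasureTheory FourierTransform
open scoped ENNReal NNReal

noncomputable section

/-- `η` is an admissible bump function: smooth, valued in `[0,1]`, equal to `1` on `|t| ≤ 1`
and vanishing for `|t| ≥ 2`. -/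
def IsBump (η : ℝ → ℝ) : Prop :=
  ContDiff ℝ (⊤ : ℕ∞) η ∧ (∀ t, η t ∈ Set.Icc (0:ℝ) 1) ∧ (∀ t, |t| ≤ 1 → η t = 1) ∧
    (∀ t, 2 ≤ |t| → η t = 0)

/-- The Littlewood–Paley pieces: `φ_0(ξ) = η(|ξ|)`,
`φ_j(ξ) = η(2^{-j}|ξ|) - η(2^{-j+1}|ξ|)` for `j ≥ 1`. -/
def littlewood (η : ℝ → ℝ) {d : ℕ} (j : ℕ) (ξ : EuclideanSpace ℝ (Fin d)) : ℝ :=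
  if j = 0 then η ‖ξ‖
  else η ((2:ℝ) ^ (-(j:ℝ)) * ‖ξ‖) - η ((2:ℝ) ^ (-(j:ℝ) + 1) * ‖ξ‖)

/-- The dyadic decomposition operator `Δ_j f = 𝓕⁻¹(φ_j 𝓕 f)`. -/
def dyadicBox (η : ℝ → ℝ) {d : ℕ} (j : ℕ) (f : EuclideanSpace ℝ (Fin d) → ℂ) :
    EuclideanSpace ℝ (Fin d) → ℂ :=
  𝓕⁻ (fun ξ => (littlewood η j ξ : ℂ) * 𝓕 f ξ)

/-- The `ℓ^q` combination of a family of extended nonnegative reals, with the supremum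
modification for `q = ∞`. -/
def lqSum {ι : Type*} (q : ℝ≥0∞) (a : ι → ℝ≥0∞) : ℝ≥0∞ :=
  if q = ∞ then ⨆ i, a i else (∑' i, a i ^ q.toReal) ^ (1 / q.toReal)

/-- The Besov quasi-norm `‖f‖_{B^s_{p,q}(ℝ^d)} = (Σ_j 2^{jsq} ‖Δ_j f‖_p^q)^{1/q}`. -/
def besovNorm (η : ℝ → ℝ) {d : ℕ} (s : ℝ) (p q : ℝ≥0∞)
    (f : EuclideanSpace ℝ (Fin d) → ℂ) : ℝ≥0∞ :=
  lqSum q (fun j : ℕ =>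
    ENNReal.ofReal ((2:ℝ) ^ ((j:ℝ) * s)) * eLpNorm (dyadicBox η j f) p volume)

/-- The logarithmically weighted Besov quasi-norm
`‖f‖_{B̃^s_{p,q}(ℝ^d)} = (Σ_j (1+j) 2^{jsq} ‖Δ_j f‖_p^q)^{1/q}`. -/
def besovNormLog (η : ℝ → ℝ) {d : ℕ} (s : ℝ) (p q : ℝ≥0∞)
    (f : EuclideanSpace ℝ (Fin d) → ℂ) : ℝ≥0∞ :=
  if q = ∞ then
    ⨆ j : ℕ, ENNReal.ofReal ((2:ℝ) ^ ((j:ℝ) * s)) * eLpNorm (dyadicBox η j f) p volume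
  else
    (∑' j : ℕ, (1 + (j:ℝ≥0∞)) *
        (ENNReal.ofReal ((2:ℝ) ^ ((j:ℝ) * s)) *
          eLpNorm (dyadicBox η j f) p volume) ^ q.toReal) ^ (1 / q.toReal)

/-- The trace `(Tr f)(x̄) = f(x̄, 0)` on the hyperplane `x_n = 0`. -/
def traceFn {m : ℕ} (f : EuclideanSpace ℝ (Fin (m+1)) → ℂ)
    (x : EuclideanSpace ℝ (Fin m)) : ℂ :=
  f ((WithLp.equiv 2 (Fin (m+1) → ℝ)).symm
      (Fin.snoc ((WithLp.equiv 2 (Fin m → ℝ)) x) 0))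

/-- The Lizorkin shell `A_0 = [-1,1]ⁿ`, `A_k = {ξ : 2^{k-1} < max_j |ξ_j| ≤ 2^k}` (`k ≥ 1`). -/
def lizorkinShell {m : ℕ} (k : ℕ) : Set (EuclideanSpace ℝ (Fin (m+1))) :=
  if k = 0 then {ξ | ∀ j, |ξ j| ≤ 1}
  else {ξ | (2:ℝ)^(k-1) < ⨆ j, |ξ j| ∧ (⨆ j, |ξ j|) ≤ (2:ℝ)^k}

/-- The part `S_k` of `A_k` adjacent to the `ξ_n`-axis:
`S_0 = A_0`, `S_k = {ξ ∈ A_k : |ξ_m| ≤ 2^{k-1}, 1 ≤ m ≤ n-1}` (`k ≥ 1`). -/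
def lizorkinAxis {m : ℕ} (k : ℕ) : Set (EuclideanSpace ℝ (Fin (m+1))) :=
  if k = 0 then lizorkinShell (m := m) 0
  else {ξ | ξ ∈ lizorkinShell (m := m) k ∧ ∀ i : Fin m, |ξ i.castSucc| ≤ (2:ℝ)^(k-1)}

/-- The frequency cut-off `𝓕⁻¹(χ_E 𝓕 f)`. -/
def cutBox {d : ℕ} (E : Set (EuclideanSpace ℝ (Fin d)))
    (f : EuclideanSpace ℝ (Fin d) → ℂ) : EuclideanSpace ℝ (Fin d) → ℂ :=
  𝓕⁻ (fun ξ => E.indicator (fun _ => (1:ℂ)) ξ * 𝓕 f ξ)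

/-- `a_k(f) = ‖𝓕⁻¹(χ_{S_k} 𝓕 f)‖_{L^p}`. -/
def aCoef {m : ℕ} (p : ℝ≥0∞) (k : ℕ) (f : EuclideanSpace ℝ (Fin (m+1)) → ℂ) : ℝ≥0∞ :=
  eLpNorm (cutBox (lizorkinAxis (m := m) k) f) p volume

/-- `b_k(f) = ‖𝓕⁻¹(χ_{A_k∖S_k} 𝓕 f)‖_{L^p}`. -/
def bCoef {m : ℕ} (p : ℝ≥0∞) (k : ℕ) (f : EuclideanSpace ℝ (Fin (m+1)) → ℂ) : ℝ≥0∞ :=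
  eLpNorm (cutBox (lizorkinShell (m := m) k \ lizorkinAxis (m := m) k) f) p volume

theorem bump_contDiff {V : Type*} [NormedAddCommGroup V] [InnerProductSpace ℝ V]
    {η : ℝ → ℝ} (hη : IsBump η) {c : ℝ} (hc : 0 < c) :
    ContDiff ℝ (⊤:ℕ∞) (fun ξ : V => ((η (c * ‖ξ‖) : ℝ) : ℂ)) := by
  refine Complex.ofRealCLM.contDiff.comp ?_
  rw [contDiff_iff_contDiffAt]
  intro x
  by_cases hx : x = 0
  · have : (fun ξ : V => η (c * ‖ξ‖)) =ᶠ[nhds x] fun _ => (1:ℝ) := by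
      have : {ξ : V | c * ‖ξ‖ < 1} ∈ nhds x := by
        apply IsOpen.mem_nhds
        · exact isOpen_lt (by fun_prop) (by fun_prop)
        · simp [hx]
      filter_upwards [this] with ξ hξ
      apply hη.2.2.1
      rw [abs_of_nonneg (by positivity)]
      exact le_of_lt hξ
    exact contDiffAt_const.congr_of_eventuallyEq this
  · exact hη.1.contDiffAt.comp x (contDiffAt_const.mul (contDiffAt_norm ℝ hx))

theorem bump_compact {V : Type*} [NormedAddCommGroup V] [InnerProductSpace ℝ V]
    [FiniteDimensional ℝ V]
    {η : ℝ → ℝ} (hη : IsBump η) {c : ℝ} (hc : 0 < c) :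
    HasCompactSupport (fun ξ : V => ((η (c * ‖ξ‖) : ℝ) : ℂ)) := by
  apply HasCompactSupport.intro (K := Metric.closedBall 0 (2/c)) (isCompact_closedBall _ _)
  intro x hx
  simp only [Metric.mem_closedBall, dist_zero_right, not_le] at hx
  rw [hη.2.2.2]
  · simp
  · rw [abs_of_nonneg (by positivity)]
    rw [div_lt_iff₀ hc] at hx
    linarith

theorem fourier_scale {V : Type*} [NormedAddCommGroup V] [InnerProductSpace ℝ V]
    [FiniteDimensional ℝ V] [MeasurableSpace V] [BorelSpace V] (g : V → ℂ) {c : ℝ} (hc : 0 < c)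
    (x : V) : 𝓕 (fun ξ => g (c • ξ)) x = (c ^ Module.finrank ℝ V)⁻¹ • 𝓕 g (c⁻¹ • x) := by
  rw [Real.fourier_eq, Real.fourier_eq]
  have := Measure.integral_comp_smul (volume : Measure V)
    (fun v => Real.fourierChar (-inner ℝ v (c⁻¹ • x)) • g v) c
  rw [abs_of_pos (by positivity)] at this
  rw [← this]
  congr 1
  ext v
  congr 3
  rw [inner_smul_left, inner_smul_right]
  simp [hc.ne']

theorem lintegral_smul_comp {V : Type*} [NormedAddCommGroup V] [InnerProductSpace ℝ V]
    [FiniteDimensional ℝ V] [MeasurableSpace V] [BorelSpace V] (g : V → ℝ≥0∞) {c : ℝ}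
    (hc : 0 < c) : ∫⁻ x, g (c • x) = ENNReal.ofReal ((c ^ Module.finrank ℝ V)⁻¹) * ∫⁻ x, g x := by
  have h1 := lintegral_map_equiv (μ := volume) g
    (Homeomorph.smul (isUnit_iff_ne_zero.2 hc.ne').unit : V ≃ₜ V).toMeasurableEquiv
  have h2 := Measure.map_addHaar_smul (volume : Measure V) hc.ne'
  rw [abs_of_pos (by positivity)] at h2
  have : ((Homeomorph.smul (isUnit_iff_ne_zero.2 hc.ne').unit :
      V ≃ₜ V).toMeasurableEquiv : V → V) = (c • ·) := by
    ext; rfl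
  rw [← smul_eq_mul, ← lintegral_smul_measure, ← h2, ← this, h1]
  rfl

theorem fourier_scale_L1 {V : Type*} [NormedAddCommGroup V] [InnerProductSpace ℝ V]
    [FiniteDimensional ℝ V] [MeasurableSpace V] [BorelSpace V] (g : V → ℂ) {c : ℝ} (hc : 0 < c) :
    ∫⁻ x, ‖𝓕 (fun ξ => g (c • ξ)) x‖ₑ = ∫⁻ x, ‖𝓕 g x‖ₑ := by
  simp_rw [fourier_scale g hc, enorm_smul]
  have hc' : 0 < c⁻¹ := by positivity
  rw [lintegral_const_mul' _ _ (by simp), lintegral_smul_comp (fun x => ‖𝓕 g x‖ₑ) hc', ← mul_assoc]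
  have : ‖(c ^ Module.finrank ℝ V)⁻¹‖ₑ * ENNReal.ofReal ((c⁻¹ ^ Module.finrank ℝ V)⁻¹) = 1 := by
    rw [Real.enorm_of_nonneg (by positivity), ← ENNReal.ofReal_mul (by positivity)]
    simp [hc.ne']
  rw [this, one_mul]


/-- The dilated bump as a Schwartz function. -/
def bumpS {V : Type*} [NormedAddCommGroup V] [InnerProductSpace ℝ V]
    [FiniteDimensional ℝ V] {η : ℝ → ℝ} (hη : IsBump η) {c : ℝ} (hc : 0 < c) : SchwartzMap V ℂ :=
  (bump_compact hη hc).toSchwartzMap (bump_contDiff hη hc)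

theorem bumpS_coe {V : Type*} [NormedAddCommGroup V] [InnerProductSpace ℝ V]
    [FiniteDimensional ℝ V] {η : ℝ → ℝ} (hη : IsBump η) {c : ℝ} (hc : 0 < c) :
    ⇑(bumpS hη hc : SchwartzMap V ℂ) = fun ξ : V => ((η (c * ‖ξ‖) : ℝ) : ℂ) := rfl

theorem bumpS_scale {V : Type*} [NormedAddCommGroup V] [InnerProductSpace ℝ V]
    [FiniteDimensional ℝ V] {η : ℝ → ℝ} (hη : IsBump η) {c : ℝ} (hc : 0 < c) :
    ⇑(bumpS hη hc : SchwartzMap V ℂ) = fun ξ : V => bumpS hη one_pos (c • ξ) := by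
  rw [bumpS_coe, bumpS_coe]
  ext ξ
  show _ = ((η (1 * ‖c • ξ‖) : ℝ) : ℂ)
  rw [norm_smul, Real.norm_of_nonneg hc.le, one_mul]

theorem bumpS_fourier_L1 {V : Type*} [NormedAddCommGroup V] [InnerProductSpace ℝ V]
    [FiniteDimensional ℝ V] [MeasurableSpace V] [BorelSpace V] {η : ℝ → ℝ} (hη : IsBump η)
    {c : ℝ} (hc : 0 < c) :
    ∫⁻ x, ‖𝓕 (⇑(bumpS hη hc : SchwartzMap V ℂ)) x‖ₑ =
      ∫⁻ x, ‖𝓕 (⇑(bumpS hη one_pos : SchwartzMap V ℂ)) x‖ₑ := by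
  rw [bumpS_scale hη hc]
  exact fourier_scale_L1 _ hc

theorem schwartz_lintegral_lt_top {V : Type*} [NormedAddCommGroup V] [InnerProductSpace ℝ V]
    [FiniteDimensional ℝ V] [MeasurableSpace V] [BorelSpace V] (S : SchwartzMap V ℂ) :
    ∫⁻ x, ‖S x‖ₑ < ∞ := S.integrable.2

theorem littlewood_schwartz {d : ℕ} {η : ℝ → ℝ} (hη : IsBump η) (j : ℕ) :
    ∃ S : SchwartzMap (EuclideanSpace ℝ (Fin d)) ℂ, (∀ ξ, S ξ = (littlewood η j ξ : ℂ)) ∧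
      ∫⁻ x, ‖𝓕 (⇑S) x‖ₑ ≤ 2 * ∫⁻ x, ‖𝓕 (⇑(bumpS hη one_pos :
        SchwartzMap (EuclideanSpace ℝ (Fin d)) ℂ)) x‖ₑ := by
  by_cases hj : j = 0
  · refine ⟨bumpS hη one_pos, ?_, ?_⟩
    · intro ξ; simp [bumpS_coe, littlewood, hj]
    · rw [two_mul]; exact le_self_add
  · have h1 : (0:ℝ) < (2:ℝ) ^ (-(j:ℝ)) := by positivity
    have h2 : (0:ℝ) < (2:ℝ) ^ (-(j:ℝ) + 1) := by positivity
    refine ⟨bumpS hη h1 + (-bumpS hη h2), ?_, ?_⟩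
    · intro ξ; simp [bumpS_coe, littlewood, hj, sub_eq_add_neg]
    · rw [← SchwartzMap.fourier_coe, FourierTransform.fourier_add, FourierTransform.fourier_neg]
      calc _ ≤ ∫⁻ x, (‖𝓕 (⇑(bumpS hη h1 : SchwartzMap (EuclideanSpace ℝ (Fin d)) ℂ)) x‖ₑ +
              ‖𝓕 (⇑(bumpS hη h2 : SchwartzMap (EuclideanSpace ℝ (Fin d)) ℂ)) x‖ₑ) := by
            apply lintegral_mono
            intro x
            rw [← SchwartzMap.fourier_coe, ← SchwartzMap.fourier_coe]
            refine (enorm_add_le _ _).trans ?_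
            simp
        _ = _ := by
            rw [lintegral_add_left, bumpS_fourier_L1 hη h1, bumpS_fourier_L1 hη h2, two_mul]
            rw [← SchwartzMap.fourier_coe]
            exact (SchwartzMap.continuous (𝓕 (bumpS hη h1 :
              SchwartzMap (EuclideanSpace ℝ (Fin d)) ℂ))).measurable.enorm

theorem bumpS_fourier_sup {η : ℝ → ℝ} (hη : IsBump η)
    {c : ℝ} (hc : 0 < c) (t : ℝ) :
    ‖𝓕 (⇑(bumpS hη hc : SchwartzMap ℝ ℂ)) t‖ₑ ≤ 
      ENNReal.ofReal c⁻¹ * ∫⁻ x : ℝ, ‖(bumpS hη one_pos : SchwartzMap ℝ ℂ) x‖ₑ := by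
  rw [Real.fourier_eq]
  refine (enorm_integral_le_lintegral_enorm _).trans ?_
  have h := lintegral_smul_comp (fun x : ℝ => ‖(bumpS hη one_pos : SchwartzMap ℝ ℂ) x‖ₑ) hc
  simp only [Module.finrank_self, pow_one] at h
  rw [← h]
  apply le_of_eq
  congr 1
  ext v
  rw [← congrFun (bumpS_scale hη hc) v]
  rw [← ofReal_norm, ← ofReal_norm, Circle.norm_smul]

/-- Fubini for Fourier-type integrals. -/
theorem fubini_fourier {V W : Type*} [NormedAddCommGroup V] [InnerProductSpace ℝ V]
    [FiniteDimensional ℝ V] [MeasurableSpace V] [BorelSpace V]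
    [NormedAddCommGroup W] [InnerProductSpace ℝ W]
    [FiniteDimensional ℝ W] [MeasurableSpace W] [BorelSpace W] (P : W →L[ℝ] V)
    {A : V → ℂ} {u : W → ℂ} (hA : Integrable A) (hu : Integrable u) :
    ∫ y, A y * (∫ ξ, Real.fourierChar (inner ℝ (P ξ) y) • u ξ) = ∫ ξ, 𝓕⁻ A (P ξ) * u ξ := by
  have := VectorFourier.integral_fourierIntegral_smul_eq_flip (e := Real.fourierChar)
    (μ := (volume : Measure V)) (ν := (volume : Measure W))
    (L := -((innerₗ V).compl₂ P.toLinearMap)) Real.continuous_fourierChar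
    (by simp; fun_prop) hA hu
  simp only [VectorFourier.fourierIntegral, smul_eq_mul] at this
  simp only [Real.fourierInv_eq]
  simp only [LinearMap.neg_apply, LinearMap.compl₂_apply, LinearMap.flip_apply, neg_neg,
    innerₗ_apply_apply, ContinuousLinearMap.coe_coe] at this
  rw [this]
  simp_rw [real_inner_comm]

/-- modulated function -/
def modul {V : Type*} [NormedAddCommGroup V] [InnerProductSpace ℝ V] (x : V) (φ : V → ℂ) (v : V) :
    ℂ := Real.fourierChar (inner ℝ v x) • φ v

theorem modul_cont {V : Type*} [NormedAddCommGroup V] [InnerProductSpace ℝ V] (x : V)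
    {φ : V → ℂ} (h : Continuous φ) : Continuous (modul x φ) := by
  unfold modul
  have : Continuous fun v : V => Real.fourierChar (inner ℝ v x) := 
    Real.continuous_fourierChar.comp (by fun_prop)
  exact this.smul h

theorem modul_enorm {V : Type*} [NormedAddCommGroup V] [InnerProductSpace ℝ V] (x : V)
    (φ : V → ℂ) (v : V) : ‖modul x φ v‖ = ‖φ v‖ := by
  rw [modul, Circle.norm_smul]

theorem modul_integrable {V : Type*} [NormedAddCommGroup V] [InnerProductSpace ℝ V] 
    [MeasurableSpace V] [BorelSpace V] [FiniteDimensional ℝ V] (x : V)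
    {φ : V → ℂ} (h : Continuous φ) (h' : Integrable φ) : Integrable (modul x φ) := 
  h'.congr' (modul_cont x h).aestronglyMeasurable (by simp [modul_enorm])

theorem modul_fourier {V : Type*} [NormedAddCommGroup V] [InnerProductSpace ℝ V] 
    [MeasurableSpace V] [BorelSpace V] [FiniteDimensional ℝ V] (x : V)
    (φ : V → ℂ) (y : V) : 𝓕 (modul x φ) y = 𝓕 φ (y - x) := by
  rw [Real.fourier_eq, Real.fourier_eq]
  congr 1
  ext v
  rw [modul, smul_smul, ← AddChar.map_add_eq_mul]
  congr 3
  rw [inner_sub_right]; ring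

/-- The embedding `(x, t) ↦ (x, t)` of `ℝ^m × ℝ` into `ℝ^{m+1}`. -/
def joinE {m : ℕ} (z : EuclideanSpace ℝ (Fin m) × ℝ) : EuclideanSpace ℝ (Fin (m+1)) :=
  WithLp.toLp 2 (Fin.snoc (WithLp.ofLp z.1) z.2 : Fin (m+1) → ℝ)

/-- The projection onto the first `m` coordinates. -/
def projE (m : ℕ) : EuclideanSpace ℝ (Fin (m+1)) →L[ℝ] EuclideanSpace ℝ (Fin m) :=
  LinearMap.toContinuousLinearMap
    { toFun := fun ξ => WithLp.toLp 2 (fun i => ξ i.castSucc)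
      map_add' := fun x y => by ext; simp
      map_smul' := fun c x => by ext; simp }

theorem projE_apply {m : ℕ} (ξ : EuclideanSpace ℝ (Fin (m+1))) (i : Fin m) :
    projE m ξ i = ξ i.castSucc := rfl

theorem projE_joinE {m : ℕ} (z : EuclideanSpace ℝ (Fin m) × ℝ) : projE m (joinE z) = z.1 := by
  ext i
  rw [projE_apply]
  simp [joinE]

theorem joinE_last {m : ℕ} (z : EuclideanSpace ℝ (Fin m) × ℝ) : joinE z (Fin.last m) = z.2 := by
  simp [joinE]

theorem inner_joinE {m : ℕ} (ξ : EuclideanSpace ℝ (Fin (m+1)))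
    (z : EuclideanSpace ℝ (Fin m) × ℝ) :
    inner ℝ ξ (joinE z) = inner ℝ (projE m ξ) z.1 + ξ (Fin.last m) * z.2 := by
  simp [PiLp.inner_apply, Fin.sum_univ_castSucc, joinE, projE_apply, mul_comm]

theorem inner_joinE' {m : ℕ} (ξ : EuclideanSpace ℝ (Fin (m+1)))
    (z : EuclideanSpace ℝ (Fin m) × ℝ) :
    inner ℝ (joinE z) ξ = inner ℝ z.1 (projE m ξ) + z.2 * ξ (Fin.last m) := by
  rw [real_inner_comm, inner_joinE, real_inner_comm, mul_comm]

theorem traceFn_eq {m : ℕ} (f : EuclideanSpace ℝ (Fin (m+1)) → ℂ) (x : EuclideanSpace ℝ (Fin m)) :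
    traceFn f x = f (joinE (x, 0)) := rfl

theorem joinE_mp (m : ℕ) : MeasurePreserving (joinE (m := m)) := by
  have h1 := PiLp.volume_preserving_toLp (Fin (m+1))
  have h2 := (volume_preserving_piFinSuccAbove (fun _ : Fin (m+1) => ℝ) (Fin.last m)).symm
  have h3 : MeasurePreserving (Prod.swap : (Fin m → ℝ) × ℝ → ℝ × (Fin m → ℝ))
    (volume.prod volume) (volume.prod volume) := Measure.measurePreserving_swap
  have h4 : MeasurePreserving (Prod.map (@WithLp.ofLp 2 (Fin m → ℝ)) (id : ℝ → ℝ))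
    (volume.prod volume) (volume.prod volume) :=
      (PiLp.volume_preserving_ofLp (Fin m)).prod (MeasurePreserving.id volume)
  have := h1.comp (h2.comp (h3.comp h4))
  rw [Measure.volume_eq_prod]
  convert this using 1
  ext z i
  simp [joinE, MeasurableEquiv.piFinSuccAbove, Fin.insertNthEquiv]

theorem joinE_me (m : ℕ) : MeasurableEmbedding (joinE (m := m)) := by
  refine MeasurableEmbedding.of_measurable_inverse (g := fun ξ => (projE m ξ, ξ (Fin.last m)))
    (joinE_mp m).measurable ?_ ?_ ?_
  · have : Set.range (joinE (m := m)) = Set.univ := by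
      rw [Set.eq_univ_iff_forall]
      intro ξ
      refine ⟨(projE m ξ, ξ (Fin.last m)), ?_⟩
      ext i
      refine Fin.lastCases ?_ (fun i => ?_) i
      · simp [joinE]
      · simp [joinE, projE_apply]
    rw [this]; exact MeasurableSet.univ
  · apply Continuous.measurable
    fun_prop
  · intro z
    ext1
    · exact projE_joinE z
    · exact joinE_last z

theorem trace_integrable {m : ℕ} (f : SchwartzMap (EuclideanSpace ℝ (Fin (m+1))) ℂ) :
    Integrable (traceFn (⇑f)) := by
  have hn : ∀ x : EuclideanSpace ℝ (Fin m), ‖x‖ = ‖joinE (x, 0)‖ := by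
    intro x
    have := inner_joinE (joinE (x,0)) (x, 0)
    rw [projE_joinE, joinE_last, real_inner_self_eq_norm_sq] at this
    simp only [real_inner_self_eq_norm_sq] at this
    rw [← abs_norm, ← abs_norm (joinE (x,0)), ← sq_eq_sq_iff_abs_eq_abs, this]; ring
  let J : EuclideanSpace ℝ (Fin m) →ₗᵢ[ℝ] EuclideanSpace ℝ (Fin (m+1)) :=
    { toFun := fun x => joinE (x, 0)
      map_add' := fun x y => by
        ext i
        refine Fin.lastCases ?_ (fun i => ?_) i <;> simp [joinE]
      map_smul' := fun c x => by
        ext i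
        refine Fin.lastCases ?_ (fun i => ?_) i <;> simp [joinE]
      norm_map' := fun x => (hn x).symm }
  have := (SchwartzMap.compCLMOfAntilipschitz ℂ
    (J.toContinuousLinearMap.hasTemperateGrowth) J.antilipschitz f).integrable (μ := volume)
  exact this

theorem modul_inv {V : Type*} [NormedAddCommGroup V] [InnerProductSpace ℝ V]
    [MeasurableSpace V] [BorelSpace V] [FiniteDimensional ℝ V] (x : V) (S : SchwartzMap V ℂ) :
    Integrable (𝓕 (modul x ⇑S)) ∧ 𝓕⁻ (𝓕 (modul x ⇑S)) = modul x ⇑S := by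
  have h1 : Integrable (𝓕 (modul x ⇑S)) := by
    have : 𝓕 (modul x ⇑S) = fun y => 𝓕 (⇑S) (y - x) := by
      ext y; exact modul_fourier x _ y
    rw [this]
    have h := (𝓕 S).integrable (μ := volume)
    rw [SchwartzMap.fourier_coe] at h
    exact h.comp_sub_right x
  exact ⟨h1, (modul_cont x S.continuous).fourierInv_fourier_eq
    (modul_integrable x S.continuous S.integrable) h1⟩

theorem fourier_mul_swap {V : Type*} [NormedAddCommGroup V] [InnerProductSpace ℝ V]
    [MeasurableSpace V] [BorelSpace V] [FiniteDimensional ℝ V] {f g : V → ℂ}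
    (hf : Integrable f) (hg : Integrable g) : ∫ v, f v * 𝓕 g v = ∫ v, 𝓕 f v * g v := by
  have := VectorFourier.integral_fourierIntegral_smul_eq_flip (e := Real.fourierChar)
    (μ := (volume : Measure V)) (ν := (volume : Measure V))
    (L := innerₗ V) Real.continuous_fourierChar
    (by simp; fun_prop) hf hg
  simp only [flip_innerₗ, smul_eq_mul] at this
  exact this.symm

/-- The trace of the frequency-localized piece. -/
theorem dyadic_trace {m : ℕ} {η : ℝ → ℝ} (j : ℕ)
    (S : SchwartzMap (EuclideanSpace ℝ (Fin m)) ℂ) (hS : ∀ ξ, S ξ = (littlewood η j ξ : ℂ))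
    (f : SchwartzMap (EuclideanSpace ℝ (Fin (m+1))) ℂ) (x : EuclideanSpace ℝ (Fin m)) :
    dyadicBox η j (traceFn (⇑f)) x = ∫ ξ, modul x (⇑S) (projE m ξ) * 𝓕 (⇑f) ξ := by
  have hF : Integrable (𝓕 (⇑f)) := by
    rw [← SchwartzMap.fourier_coe]; exact (𝓕 f).integrable
  have h1 : dyadicBox η j (traceFn (⇑f)) x = ∫ v, modul x (⇑S) v * 𝓕 (traceFn (⇑f)) v := by
    rw [dyadicBox, Real.fourierInv_eq]
    congr 1
    ext v
    rw [modul, hS, smul_mul_assoc]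
  have h2 : ∀ y, traceFn (⇑f) y =
      ∫ ξ, Real.fourierChar (inner ℝ (projE m ξ) y) • 𝓕 (⇑f) ξ := by
    intro y
    rw [traceFn_eq]
    have : 𝓕⁻ (𝓕 (⇑f)) = ⇑f := f.continuous.fourierInv_fourier_eq f.integrable hF
    rw [← congrFun this, Real.fourierInv_eq]
    congr 1
    ext ξ
    rw [inner_joinE]
    simp
  obtain ⟨h3, h4⟩ := modul_inv x S
  rw [h1, fourier_mul_swap (modul_integrable x S.continuous S.integrable) (trace_integrable f)]
  simp_rw [h2]
  rw [fubini_fourier (projE m) h3 hF, h4]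

theorem prod_fourierInv {m : ℕ} (A : EuclideanSpace ℝ (Fin m) → ℂ) (B : ℝ → ℂ)
    (ξ : EuclideanSpace ℝ (Fin (m+1))) :
    𝓕⁻ (fun z => A (projE m z) * B (z (Fin.last m))) ξ =
      𝓕⁻ A (projE m ξ) * 𝓕⁻ B (ξ (Fin.last m)) := by
  rw [Real.fourierInv_eq, ← (joinE_mp m).integral_comp (joinE_me m), Real.fourierInv_eq,
    Real.fourierInv_eq, Measure.volume_eq_prod, ← integral_prod_mul]
  congr 1
  ext z
  rw [projE_joinE, joinE_last, inner_joinE', AddChar.map_add_eq_mul]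
  simp only [Circle.smul_def, Circle.coe_mul, smul_eq_mul, RCLike.inner_apply, conj_trivial]
  rw [mul_comm z.2]
  ring

theorem prod_lintegral {m : ℕ} {A : EuclideanSpace ℝ (Fin m) → ℝ≥0∞} {B : ℝ → ℝ≥0∞}
    (hA : Measurable A) (hB : Measurable B) :
    ∫⁻ z : EuclideanSpace ℝ (Fin (m+1)), A (projE m z) * B (z (Fin.last m)) =
      (∫⁻ x, A x) * ∫⁻ t, B t := by
  rw [← (joinE_mp m).lintegral_comp_emb (joinE_me m), Measure.volume_eq_prod,
    ← lintegral_prod_mul hA.aemeasurable hB.aemeasurable]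
  congr 1
  ext z
  rw [projE_joinE, joinE_last]

theorem prod_integrable {m : ℕ} {A : EuclideanSpace ℝ (Fin m) → ℂ} {B : ℝ → ℂ}
    (hA : Integrable A) (hB : Integrable B) :
    Integrable (fun z : EuclideanSpace ℝ (Fin (m+1)) => A (projE m z) * B (z (Fin.last m))) := by
  rw [← (joinE_mp m).integrable_comp_emb (joinE_me m), Measure.volume_eq_prod]
  refine (hA.mul_prod hB).congr ?_
  filter_upwards with z
  simp only [Function.comp, projE_joinE, joinE_last]

/-- Jensen/Hölder with a weight. -/
theorem weighted_jensen {α : Type*} [MeasurableSpace α] (μ : Measure α) {p : ℝ} (hp : 1 < p)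
    {W G : α → ℝ≥0∞} (hW : Measurable W) (hG : Measurable G) :
    (∫⁻ z, W z * G z ∂μ) ^ p ≤ (∫⁻ z, W z ∂μ) ^ (p - 1) * ∫⁻ z, W z * G z ^ p ∂μ := by
  have hpq : p.HolderConjugate (Real.conjExponent p) := Real.HolderConjugate.conjExponent hp
  have h := ENNReal.lintegral_mul_le_Lp_mul_Lq (μ.withDensity W) hpq (f := G)
    (g := fun _ => 1) hG.aemeasurable aemeasurable_const
  have h' := ENNReal.rpow_le_rpow h (z := p) (by linarith)
  have hp0 : p ≠ 0 := by linarith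
  rw [ENNReal.mul_rpow_of_nonneg _ _ (by linarith), ← ENNReal.rpow_mul, one_div_mul_cancel hp0,
    ENNReal.rpow_one, ← ENNReal.rpow_mul] at h'
  have e : 1 / Real.conjExponent p * p = p - 1 := by
    rw [Real.conjExponent]; field_simp
  rw [e] at h'
  rw [lintegral_withDensity_eq_lintegral_mul _ hW (hG.mul measurable_const),
    lintegral_withDensity_eq_lintegral_mul _ hW (hG.pow_const p),
    lintegral_withDensity_eq_lintegral_mul _ hW measurable_const] at h'
  simpa [mul_comm] using h'

theorem fourierInv_cont {V : Type*} [NormedAddCommGroup V] [InnerProductSpace ℝ V]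
    [MeasurableSpace V] [BorelSpace V] [FiniteDimensional ℝ V] {u : V → ℂ} (hu : Integrable u) :
    Continuous (𝓕⁻ u) := by
  have h := VectorFourier.fourierIntegral_continuous (e := Real.fourierChar)
    (μ := (volume : Measure V)) (L := innerₗ V) Real.continuous_fourierChar
    (by simp; fun_prop) hu
  have h2 : 𝓕⁻ u = fun w => 𝓕 u (-w) := by
    ext w; exact Real.fourierInv_eq_fourier_neg u w
  rw [h2]
  exact h.comp continuous_neg

theorem nikolskii {m : ℕ} (S : SchwartzMap (EuclideanSpace ℝ (Fin m)) ℂ) (B : SchwartzMap ℝ ℂ)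
    {N I V : ℝ≥0∞} (hN : ∫⁻ x, ‖𝓕 (⇑S) x‖ₑ ≤ N) (hI : ∫⁻ x, ‖𝓕 (⇑B) x‖ₑ ≤ I)
    (hV : ∀ t, ‖𝓕 (⇑B) t‖ₑ ≤ V) {u : EuclideanSpace ℝ (Fin (m+1)) → ℂ} (hu : Integrable u)
    (hB : ∀ ξ, u ξ ≠ 0 → B (ξ (Fin.last m)) = 1) {p : ℝ} (hp : 1 < p) :
    ∫⁻ x, ‖∫ ξ, modul x (⇑S) (projE m ξ) * u ξ‖ₑ ^ p ≤
      ((N * I) ^ (p - 1) * (N * V)) * ∫⁻ z, ‖𝓕⁻ u z‖ₑ ^ p := by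
  have mS : Measurable (fun x => ‖𝓕 (⇑S) x‖ₑ) := by
    rw [← SchwartzMap.fourier_coe]; exact (𝓕 S).continuous.measurable.enorm
  have mB : Measurable (fun x => ‖𝓕 (⇑B) x‖ₑ) := by
    rw [← SchwartzMap.fourier_coe]; exact (𝓕 B).continuous.measurable.enorm
  have mF : Measurable (fun x => ‖𝓕⁻ u x‖ₑ) := (fourierInv_cont hu).measurable.enorm
  have iB : Integrable (𝓕 (⇑B)) := by
    rw [← SchwartzMap.fourier_coe]; exact (𝓕 B).integrable
  have mP : Measurable (projE m) := (projE m).continuous.measurable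
  have mL : Measurable (fun z : EuclideanSpace ℝ (Fin (m+1)) => z (Fin.last m)) :=
    Continuous.measurable (by fun_prop)
  -- representation
  have rep : ∀ x, ∫ ξ, modul x (⇑S) (projE m ξ) * u ξ =
      ∫ z, (𝓕 (⇑S) (projE m z - x) * 𝓕 (⇑B) (z (Fin.last m))) * 𝓕⁻ u z := by
    intro x
    obtain ⟨h3, h4⟩ := modul_inv x S
    have h := fubini_fourier (ContinuousLinearMap.id ℝ _) (prod_integrable h3 iB) hu
    simp only [ContinuousLinearMap.id_apply] at h
    simp_rw [prod_fourierInv, h4, ← Real.fourierInv_eq, modul_fourier] at h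
    rw [h]
    congr 1
    ext ξ
    by_cases hξ : u ξ = 0
    · simp [hξ]
    · have : 𝓕⁻ (𝓕 (⇑B)) = ⇑B := B.continuous.fourierInv_fourier_eq B.integrable iB
      rw [this, hB ξ hξ, mul_one]
  have bound : ∀ x, ‖∫ ξ, modul x (⇑S) (projE m ξ) * u ξ‖ₑ ^ p ≤ (N * I) ^ (p - 1) *
      ∫⁻ z, (‖𝓕 (⇑S) (projE m z - x)‖ₑ * ‖𝓕 (⇑B) (z (Fin.last m))‖ₑ) * ‖𝓕⁻ u z‖ₑ ^ p := by
    intro x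
    rw [rep x]
    have m1 : Measurable (fun z : EuclideanSpace ℝ (Fin (m+1)) =>
        ‖𝓕 (⇑S) (projE m z - x)‖ₑ * ‖𝓕 (⇑B) (z (Fin.last m))‖ₑ) :=
      (mS.comp (mP.sub_const x)).mul (mB.comp mL)
    calc _ ≤ (∫⁻ z, (‖𝓕 (⇑S) (projE m z - x)‖ₑ * ‖𝓕 (⇑B) (z (Fin.last m))‖ₑ) * ‖𝓕⁻ u z‖ₑ) ^ p := by
          gcongr
          refine (enorm_integral_le_lintegral_enorm _).trans (le_of_eq ?_)
          simp_rw [enorm_mul]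
      _ ≤ _ := weighted_jensen volume hp m1 mF
      _ ≤ _ := by
          have : ∫⁻ z : EuclideanSpace ℝ (Fin (m+1)),
              ‖𝓕 (⇑S) (projE m z - x)‖ₑ * ‖𝓕 (⇑B) (z (Fin.last m))‖ₑ ≤ N * I := by
            rw [prod_lintegral (A := fun y => ‖𝓕 (⇑S) (y - x)‖ₑ)
              (mS.comp (measurable_id.sub_const x)) mB,
              lintegral_sub_right_eq_self (fun y => ‖𝓕 (⇑S) y‖ₑ)]
            gcongr
          gcongr
  calc _ ≤ ∫⁻ x, (N * I) ^ (p - 1) *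
      ∫⁻ z, (‖𝓕 (⇑S) (projE m z - x)‖ₑ * ‖𝓕 (⇑B) (z (Fin.last m))‖ₑ) * ‖𝓕⁻ u z‖ₑ ^ p :=
        lintegral_mono bound
    _ = (N * I) ^ (p - 1) * ∫⁻ z, ∫⁻ x,
        (‖𝓕 (⇑S) (projE m z - x)‖ₑ * ‖𝓕 (⇑B) (z (Fin.last m))‖ₑ) * ‖𝓕⁻ u z‖ₑ ^ p := by
        have mm : Measurable (Function.uncurry
            (fun (x : EuclideanSpace ℝ (Fin m)) (z : EuclideanSpace ℝ (Fin (m+1))) =>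
            (‖𝓕 (⇑S) (projE m z - x)‖ₑ * ‖𝓕 (⇑B) (z (Fin.last m))‖ₑ) * ‖𝓕⁻ u z‖ₑ ^ p)) := by
          have h0 : Measurable (fun z : EuclideanSpace ℝ (Fin m) × EuclideanSpace ℝ (Fin (m+1)) =>
              z.2) := measurable_snd
          have h1 := mS.comp ((mP.comp h0).sub measurable_fst)
          exact (h1.mul (mB.comp (mL.comp h0))).mul ((mF.comp h0).pow_const p)
        rw [lintegral_const_mul _ mm.lintegral_prod_right, lintegral_lintegral_swap mm.aemeasurable]
    _ ≤ (N * I) ^ (p - 1) * ∫⁻ z, (N * V) * ‖𝓕⁻ u z‖ₑ ^ p := by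
        gcongr with z
        have m2 : Measurable fun x => ‖𝓕 (⇑S) (projE m z - x)‖ₑ :=
          mS.comp (measurable_const.sub measurable_id)
        rw [lintegral_mul_const _ (m2.mul_const _), lintegral_mul_const _ m2,
          lintegral_sub_left_eq_self (fun y => ‖𝓕 (⇑S) y‖ₑ)]
        gcongr
        exact hV _
    _ = _ := by
        rw [lintegral_const_mul _ (mF.pow_const p), ← mul_assoc]

theorem rpow_tsum_le {r : ℝ} (h0 : 0 < r) (h1 : r ≤ 1) (x : ℕ → ℝ≥0∞) :
    (∑' k, x k) ^ r ≤ ∑' k, x k ^ r := by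
  have hfin : ∀ s : Finset ℕ, (∑ k ∈ s, x k) ^ r ≤ ∑ k ∈ s, x k ^ r := by
    intro s
    induction s using Finset.induction_on with
    | empty => simp [h0]
    | insert a s ha ih =>
      rw [Finset.sum_insert ha, Finset.sum_insert ha]
      exact (ENNReal.rpow_add_le_add_rpow _ _ h0.le h1).trans (by gcongr)
  have ht : Filter.Tendsto (fun s : Finset ℕ => (∑ k ∈ s, x k) ^ r) Filter.atTop
      (nhds ((∑' k, x k) ^ r)) :=
    (ENNReal.continuous_rpow_const.tendsto _).comp ENNReal.summable.hasSum
  exact le_of_tendsto' ht fun s => (hfin s).trans (ENNReal.sum_le_tsum s)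

theorem lqSum_le {q : ℝ≥0∞} (hq : 0 < q) {r : ℝ} (hr : r = (min q 1).toReal) (X : ℕ → ℝ≥0∞) :
    lqSum q X ≤ (∑' j, X j ^ r) ^ (1 / r) := by
  have hmin : min q 1 ≠ ∞ := ne_top_of_le_ne_top ENNReal.one_ne_top (min_le_right _ _)
  have hr0 : 0 < r := by
    rw [hr]; exact ENNReal.toReal_pos (lt_min hq one_pos).ne' hmin
  unfold lqSum
  split_ifs with h
  · refine iSup_le fun j => ?_
    have : X j ^ r ≤ ∑' j, X j ^ r := ENNReal.le_tsum j
    calc X j = (X j ^ r) ^ (1 / r) := by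
          rw [← ENNReal.rpow_mul, mul_one_div_cancel hr0.ne', ENNReal.rpow_one]
      _ ≤ _ := by gcongr
  · have hq0 : 0 < q.toReal := ENNReal.toReal_pos hq.ne' h
    have hrq : r ≤ q.toReal := by
      rw [hr]; exact ENNReal.toReal_mono h (min_le_left _ _)
    have h1 := rpow_tsum_le (r := r / q.toReal) (by positivity)
      ((div_le_one hq0).2 hrq) (fun j => X j ^ q.toReal)
    simp_rw [← ENNReal.rpow_mul, mul_div_cancel₀ r hq0.ne'] at h1
    calc (∑' j, X j ^ q.toReal) ^ (1 / q.toReal)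
        = ((∑' j, X j ^ q.toReal) ^ (r / q.toReal)) ^ (1 / r) := by
          rw [← ENNReal.rpow_mul]; congr 1; field_simp
      _ ≤ _ := by gcongr

theorem eLpNorm_hasSum_le {α : Type*} [MeasurableSpace α] {μ : Measure α} {p : ℝ≥0∞} (hp : 1 ≤ p)
    {T : ℕ → α → ℂ} {D : α → ℂ} (hT : ∀ k, AEStronglyMeasurable (T k) μ)
    (h : ∀ x, HasSum (fun k => T k x) (D x)) :
    eLpNorm D p μ ≤ ∑' k, eLpNorm (T k) p μ := by
  refine (Lp.eLpNorm_lim_le_liminf_eLpNorm (f := fun n => ∑ k ∈ Finset.range n, T k)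
    (fun n => Finset.aestronglyMeasurable_sum _ fun k _ => hT k) D
    (Filter.Eventually.of_forall fun x => ?_)).trans ?_
  · simp only [Finset.sum_apply]
    exact (h x).tendsto_sum_nat
  · refine (Filter.liminf_le_liminf (v := fun _ => ∑' k, eLpNorm (T k) p μ)
      (Filter.Eventually.of_forall fun n => ?_)).trans (by simp)
    exact (eLpNorm_sum_le (fun k _ => hT k) hp).trans (ENNReal.sum_le_tsum _)

theorem shell_measurable {m : ℕ} (k : ℕ) : MeasurableSet (lizorkinShell (m := m) k) := by
  have h : Measurable fun ξ : EuclideanSpace ℝ (Fin (m+1)) => ⨆ j, |ξ j| :=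
    Measurable.iSup fun j => Continuous.measurable (by fun_prop)
  unfold lizorkinShell
  split_ifs
  · simp only [Set.ofPred_forall]
    exact MeasurableSet.iInter fun j => measurableSet_le (Continuous.measurable (by fun_prop))
      measurable_const
  · exact (measurableSet_lt measurable_const h).inter (measurableSet_le h measurable_const)

theorem axis_measurable {m : ℕ} (k : ℕ) : MeasurableSet (lizorkinAxis (m := m) k) := by
  unfold lizorkinAxis
  split_ifs
  · exact shell_measurable 0
  · have : MeasurableSet {ξ : EuclideanSpace ℝ (Fin (m+1)) |
        ∀ i : Fin m, |ξ i.castSucc| ≤ (2:ℝ)^(k-1)} := by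
      simp only [Set.ofPred_forall]
      exact MeasurableSet.iInter fun j => measurableSet_le (Continuous.measurable (by fun_prop))
        measurable_const
    exact (shell_measurable k).inter this

theorem axis_subset {m : ℕ} (k : ℕ) : lizorkinAxis (m := m) k ⊆ lizorkinShell k := by
  unfold lizorkinAxis
  split_ifs with h
  · rw [h]
  · exact fun ξ hξ => hξ.1

theorem mem_shell_zero {m : ℕ} (ξ : EuclideanSpace ℝ (Fin (m+1))) :
    ξ ∈ lizorkinShell (m := m) 0 ↔ ⨆ j, |ξ j| ≤ 1 := by
  simp only [lizorkinShell, if_true, Set.mem_ofPred_eq]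
  exact (ciSup_le_iff (Set.finite_range _).bddAbove).symm

theorem shell_le {m : ℕ} {k : ℕ} {ξ : EuclideanSpace ℝ (Fin (m+1))}
    (h : ξ ∈ lizorkinShell (m := m) k) : ⨆ j, |ξ j| ≤ (2:ℝ) ^ k := by
  by_cases hk : k = 0
  · subst hk; simpa using (mem_shell_zero ξ).1 h
  · simp only [lizorkinShell, if_neg hk] at h; exact h.2

theorem shell_coord_le {m : ℕ} {k : ℕ} {ξ : EuclideanSpace ℝ (Fin (m+1))}
    (h : ξ ∈ lizorkinShell (m := m) k) (i : Fin (m+1)) : |ξ i| ≤ (2:ℝ) ^ k :=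
  (le_ciSup (f := fun j => |ξ j|) (Set.finite_range _).bddAbove i).trans (shell_le h)

theorem shell_disjoint {m : ℕ} :
    Pairwise (Function.onFun Disjoint (lizorkinShell (m := m))) := by
  have key : ∀ k l : ℕ, k < l → Disjoint (lizorkinShell (m := m) k) (lizorkinShell l) := by
    intro k l hkl
    rw [Set.disjoint_left]
    intro ξ h1 h2
    have h3 := shell_le h1
    rw [lizorkinShell, if_neg (by omega)] at h2
    have h4 := h2.1
    have : (2:ℝ) ^ k ≤ 2 ^ (l - 1) := pow_le_pow_right₀ (by norm_num) (by omega)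
    linarith
  intro k l hkl
  rcases lt_or_gt_of_ne hkl with h | h
  · exact key k l h
  · exact (key l k h).symm

theorem shell_cover {m : ℕ} : ⋃ k, lizorkinShell (m := m) k = Set.univ := by
  classical
  rw [Set.eq_univ_iff_forall]
  intro ξ
  rw [Set.mem_iUnion]
  have hex : ∃ k : ℕ, ⨆ j, |ξ j| ≤ (2:ℝ) ^ k := by
    obtain ⟨n, hn⟩ := pow_unbounded_of_one_lt (⨆ j, |ξ j|) (one_lt_two (α := ℝ))
    exact ⟨n, hn.le⟩
  refine ⟨Nat.find hex, ?_⟩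
  have h1 := Nat.find_spec hex
  by_cases h0 : Nat.find hex = 0
  · rw [h0] at h1 ⊢
    rw [mem_shell_zero]; simpa using h1
  · rw [lizorkinShell, if_neg h0]
    refine ⟨?_, h1⟩
    have := Nat.find_min hex (m := Nat.find hex - 1) (by omega)
    exact not_le.1 this

theorem offaxis_norm {m : ℕ} {k : ℕ} {ξ : EuclideanSpace ℝ (Fin (m+1))}
    (h : ξ ∈ lizorkinShell (m := m) k \ lizorkinAxis (m := m) k) :
    0 < k ∧ (2:ℝ) ^ (k - 1) < ‖projE m ξ‖ := by
  obtain ⟨h1, h2⟩ := h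
  by_cases hk : k = 0
  · subst hk; simp [lizorkinAxis, h1] at h2
  · refine ⟨by omega, ?_⟩
    rw [lizorkinAxis, if_neg hk] at h2
    simp only [Set.mem_ofPred_eq, not_and, not_forall, not_le] at h2
    obtain ⟨i, hi⟩ := h2 h1
    refine hi.trans_le ?_
    rw [← projE_apply, ← Real.norm_eq_abs]
    exact PiLp.norm_apply_le _ i

theorem littlewood_zero {d : ℕ} {η : ℝ → ℝ} (hη : IsBump η) {j : ℕ}
    {x : EuclideanSpace ℝ (Fin d)} (hx : (2:ℝ) ^ (j + 1) ≤ ‖x‖) : littlewood η j x = 0 := by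
  unfold littlewood
  split_ifs with h
  · subst h
    apply hη.2.2.2
    rw [abs_norm]; simpa using hx
  · have e1 : (2:ℝ) ^ (-(j:ℝ)) * 2 ^ (j + 1) = 2 := by
      rw [Real.rpow_neg (by norm_num), Real.rpow_natCast, pow_succ]
      field_simp
    have e2 : (2:ℝ) ^ (-(j:ℝ)) ≤ 2 ^ (-(j:ℝ) + 1) :=
      Real.rpow_le_rpow_of_exponent_le (by norm_num) (by linarith)
    have e3 : 2 ≤ (2:ℝ) ^ (-(j:ℝ)) * ‖x‖ := by
      calc 2 = (2:ℝ) ^ (-(j:ℝ)) * 2 ^ (j + 1) := e1.symm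
        _ ≤ _ := mul_le_mul_of_nonneg_left hx (by positivity)
    have e4 : 2 ≤ (2:ℝ) ^ (-(j:ℝ) + 1) * ‖x‖ := e3.trans (by gcongr)
    rw [hη.2.2.2 _ (e3.trans (le_abs_self _)), hη.2.2.2 _ (e4.trans (le_abs_self _)), sub_zero]

theorem tail_tsum (ρ : ℝ≥0∞) (k : ℕ) :
    ∑' j : ℕ, (if k ≤ j then ρ ^ j else 0) = ρ ^ k * (1 - ρ)⁻¹ := by
  rw [← ENNReal.summable.sum_add_tsum_nat_add' (k := k)]
  · have : ∑ i ∈ Finset.range k, (if k ≤ i then ρ ^ i else 0) = 0 := by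
      apply Finset.sum_eq_zero
      intro i hi
      rw [Finset.mem_range] at hi
      rw [if_neg (by omega)]
    rw [this, zero_add]
    simp only [le_add_iff_nonneg_left, zero_le, if_true, pow_add]
    rw [ENNReal.tsum_mul_right, ENNReal.tsum_geometric, mul_comm]

theorem tail_tsum' {ρ : ℝ≥0∞} (h0 : ρ ≠ 0) (h1 : ρ < 1) (k : ℕ) :
    ∑' j : ℕ, (if k ≤ j + 1 then ρ ^ j else 0) ≤ (ρ⁻¹ * (1 - ρ)⁻¹) * ρ ^ k := by
  have ht : ρ ≠ ∞ := ne_top_of_lt h1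
  cases k with
  | zero =>
    simp only [Nat.zero_le, if_true, pow_zero, mul_one]
    rw [ENNReal.tsum_geometric]
    calc (1 - ρ)⁻¹ = 1 * (1 - ρ)⁻¹ := (one_mul _).symm
      _ ≤ _ := by
        gcongr
        exact ENNReal.one_le_inv.2 h1.le
  | succ k =>
    simp only [Nat.add_le_add_iff_right]
    rw [tail_tsum, pow_succ]
    apply le_of_eq
    calc ρ ^ k * (1 - ρ)⁻¹ = (ρ⁻¹ * ρ) * (ρ ^ k * (1 - ρ)⁻¹) := by
          rw [ENNReal.inv_mul_cancel h0 ht, one_mul]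
      _ = _ := by ring

theorem cut_integrable {m : ℕ} (f : SchwartzMap (EuclideanSpace ℝ (Fin (m+1))) ℂ)
    {E : Set (EuclideanSpace ℝ (Fin (m+1)))} (hE : MeasurableSet E) :
    StronglyMeasurable (fun ξ => E.indicator (fun _ => (1:ℂ)) ξ * 𝓕 (⇑f) ξ) ∧
    Integrable (fun ξ => E.indicator (fun _ => (1:ℂ)) ξ * 𝓕 (⇑f) ξ) := by
  have e : (fun ξ => E.indicator (fun _ => (1:ℂ)) ξ * 𝓕 (⇑f) ξ) = E.indicator (𝓕 (⇑f)) := by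
    ext ξ
    by_cases h : ξ ∈ E <;> simp [h]
  rw [e, ← SchwartzMap.fourier_coe]
  exact ⟨(𝓕 f).continuous.stronglyMeasurable.indicator hE, (𝓕 f).integrable.indicator hE⟩

/-- The frequency-localized trace of the cut-off of `f` to `E`. -/
def pieceT {m : ℕ} (S : SchwartzMap (EuclideanSpace ℝ (Fin m)) ℂ)
    (f : SchwartzMap (EuclideanSpace ℝ (Fin (m+1))) ℂ)
    (E : Set (EuclideanSpace ℝ (Fin (m+1)))) (x : EuclideanSpace ℝ (Fin m)) : ℂ :=
  ∫ ξ, modul x (⇑S) (projE m ξ) * (E.indicator (fun _ => (1:ℂ)) ξ * 𝓕 (⇑f) ξ)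

theorem pieceT_meas {m : ℕ} (S : SchwartzMap (EuclideanSpace ℝ (Fin m)) ℂ)
    (f : SchwartzMap (EuclideanSpace ℝ (Fin (m+1))) ℂ)
    {E : Set (EuclideanSpace ℝ (Fin (m+1)))} (hE : MeasurableSet E) :
    StronglyMeasurable (pieceT S f E) := by
  have h1 : Continuous (fun z : EuclideanSpace ℝ (Fin m) × EuclideanSpace ℝ (Fin (m+1)) =>
      modul z.1 (⇑S) (projE m z.2)) := by
    unfold modul
    have h : Continuous (fun z : EuclideanSpace ℝ (Fin m) × EuclideanSpace ℝ (Fin (m+1)) =>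
      Real.fourierChar (inner ℝ (projE m z.2) z.1)) :=
      Real.continuous_fourierChar.comp (by fun_prop)
    exact h.smul (S.continuous.comp (by fun_prop))
  have h2 := (cut_integrable f hE).1.comp_measurable
    (measurable_snd : Measurable (fun z : EuclideanSpace ℝ (Fin m) ×
      EuclideanSpace ℝ (Fin (m+1)) => z.2))
  exact (h1.stronglyMeasurable.mul h2).integral_prod_right

theorem pieceT_integrable {m : ℕ} (S : SchwartzMap (EuclideanSpace ℝ (Fin m)) ℂ)
    (f : SchwartzMap (EuclideanSpace ℝ (Fin (m+1))) ℂ) (x : EuclideanSpace ℝ (Fin m)) :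
    Integrable (fun ξ => modul x (⇑S) (projE m ξ) * 𝓕 (⇑f) ξ) := by
  have hF : Integrable (𝓕 (⇑f)) := by
    rw [← SchwartzMap.fourier_coe]; exact (𝓕 f).integrable
  obtain ⟨C, hC⟩ : ∃ C, ∀ y, ‖S y‖ ≤ C := by
    obtain ⟨C, hC⟩ := S.decay 0 0
    exact ⟨C, fun y => by simpa using hC.2 y⟩
  refine hF.bdd_mul (c := C) ((modul_cont x S.continuous).comp
    (projE m).continuous).aestronglyMeasurable ?_
  filter_upwards with ξ
  show ‖modul x (⇑S) (projE m ξ)‖ ≤ C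
  have hh : ‖modul x (⇑S) (projE m ξ)‖ = ‖S (projE m ξ)‖ := by
    rw [modul, Circle.norm_smul]
  rw [hh]
  exact hC _

theorem pieceT_eq {m : ℕ} (S : SchwartzMap (EuclideanSpace ℝ (Fin m)) ℂ)
    (f : SchwartzMap (EuclideanSpace ℝ (Fin (m+1))) ℂ)
    {E : Set (EuclideanSpace ℝ (Fin (m+1)))} (hE : MeasurableSet E)
    (x : EuclideanSpace ℝ (Fin m)) :
    pieceT S f E x = ∫ ξ in E, modul x (⇑S) (projE m ξ) * 𝓕 (⇑f) ξ := by
  rw [pieceT, ← integral_indicator hE]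
  congr 1
  ext ξ
  by_cases h : ξ ∈ E <;> simp [h]

theorem pieceT_hasSum {m : ℕ} (S : SchwartzMap (EuclideanSpace ℝ (Fin m)) ℂ)
    (f : SchwartzMap (EuclideanSpace ℝ (Fin (m+1))) ℂ) (x : EuclideanSpace ℝ (Fin m)) :
    HasSum (fun k => (pieceT S f (lizorkinAxis k) +
        pieceT S f (lizorkinShell k \ lizorkinAxis k)) x)
      (∫ ξ, modul x (⇑S) (projE m ξ) * 𝓕 (⇑f) ξ) := by
  have hi := pieceT_integrable S f x
  have h := hasSum_integral_iUnion (μ := volume) (fun k => shell_measurable (m := m) k)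
    shell_disjoint hi.integrableOn
  rw [shell_cover, setIntegral_univ] at h
  have e : (fun k => (pieceT S f (lizorkinAxis k) +
      pieceT S f (lizorkinShell k \ lizorkinAxis k)) x) =
      fun k => ∫ ξ in lizorkinShell k, modul x (⇑S) (projE m ξ) * 𝓕 (⇑f) ξ := by
    funext k
    rw [Pi.add_apply, pieceT_eq S f (axis_measurable k),
      pieceT_eq S f ((shell_measurable k).diff (axis_measurable k)), add_comm,
    ← setIntegral_union Set.disjoint_sdiff_left (axis_measurable k)
      hi.integrableOn hi.integrableOn, Set.diff_union_of_subset (axis_subset k)]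
  rw [e]
  exact h

theorem pieceT_bound {m : ℕ} {η : ℝ → ℝ} (hη : IsBump η) {p : ℝ≥0∞} (hp : 1 < p) (hp' : p ≠ ∞) :
    ∃ K : ℝ≥0∞, K ≠ ∞ ∧ ∀ (j : ℕ), ∃ S : SchwartzMap (EuclideanSpace ℝ (Fin m)) ℂ,
      (∀ ξ, S ξ = (littlewood η j ξ : ℂ)) ∧
      ∀ (k : ℕ) (f : SchwartzMap (EuclideanSpace ℝ (Fin (m+1))) ℂ)
        (E : Set (EuclideanSpace ℝ (Fin (m+1)))), MeasurableSet E → E ⊆ lizorkinShell k →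
        eLpNorm (pieceT S f E) p volume ≤
          K * ENNReal.ofReal ((2:ℝ) ^ ((k:ℝ) / p.toReal)) * eLpNorm (cutBox E (⇑f)) p volume := by
  have hp0 : p ≠ 0 := (zero_lt_one.trans hp).ne'
  have hpr : 1 < p.toReal := by
    rw [← ENNReal.toReal_one]; exact (ENNReal.toReal_lt_toReal ENNReal.one_ne_top hp').2 hp
  have hpr0 : 0 < p.toReal := by linarith
  set N := 2 * ∫⁻ x, ‖𝓕 (⇑(bumpS hη one_pos : SchwartzMap (EuclideanSpace ℝ (Fin m)) ℂ)) x‖ₑ with hN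
  set I := ∫⁻ x, ‖𝓕 (⇑(bumpS hη one_pos : SchwartzMap ℝ ℂ)) x‖ₑ with hI
  set V := ∫⁻ x : ℝ, ‖(bumpS hη one_pos : SchwartzMap ℝ ℂ) x‖ₑ with hV
  have fN : N ≠ ∞ := by
    rw [hN, ← SchwartzMap.fourier_coe]
    exact ENNReal.mul_ne_top (by simp) (schwartz_lintegral_lt_top _).ne
  have fI : I ≠ ∞ := by
    rw [hI, ← SchwartzMap.fourier_coe]
    exact (schwartz_lintegral_lt_top _).ne
  have fV : V ≠ ∞ := (schwartz_lintegral_lt_top _).ne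
  refine ⟨((N * I) ^ (p.toReal - 1) * (N * V)) ^ (1 / p.toReal), ?_, fun j => ?_⟩
  · apply ENNReal.rpow_ne_top_of_nonneg (by positivity)
    apply ENNReal.mul_ne_top _ (ENNReal.mul_ne_top fN fV)
    exact ENNReal.rpow_ne_top_of_nonneg (by linarith) (ENNReal.mul_ne_top fN fI)
  · obtain ⟨S, hS, hSN⟩ := littlewood_schwartz (d := m) hη j
    refine ⟨S, hS, fun k f E hE hEk => ?_⟩
    have hc : (0:ℝ) < ((2:ℝ) ^ k)⁻¹ := by positivity
    have hB : ∀ ξ : EuclideanSpace ℝ (Fin (m+1)), E.indicator (fun _ => (1:ℂ)) ξ * 𝓕 (⇑f) ξ ≠ 0 →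
        (bumpS hη hc : SchwartzMap ℝ ℂ) (ξ (Fin.last m)) = 1 := by
      intro ξ hξ
      have hξE : ξ ∈ E := by
        by_contra h
        simp [h] at hξ
      have h1 := shell_coord_le (hEk hξE) (Fin.last m)
      rw [bumpS_coe]
      show ((η (((2:ℝ) ^ k)⁻¹ * ‖ξ (Fin.last m)‖) : ℝ) : ℂ) = 1
      rw [hη.2.2.1, Complex.ofReal_one]
      rw [abs_of_nonneg (by positivity), Real.norm_eq_abs, inv_mul_le_iff₀ (by positivity), mul_one]
      exact h1
    have key := nikolskii S (bumpS hη hc) hSN (bumpS_fourier_L1 hη hc).le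
      (bumpS_fourier_sup hη hc) (cut_integrable f hE).2 hB hpr
    rw [eLpNorm_eq_lintegral_rpow_enorm_toReal hp0 hp',
      eLpNorm_eq_lintegral_rpow_enorm_toReal hp0 hp']
    refine (ENNReal.rpow_le_rpow key (by positivity)).trans (le_of_eq ?_)
    rw [ENNReal.mul_rpow_of_nonneg _ _ (by positivity)]
    congr 1
    rw [inv_inv, ← hI, ← hV]
    have e : ENNReal.ofReal ((2:ℝ) ^ ((k:ℝ) / p.toReal)) =
        (ENNReal.ofReal ((2:ℝ) ^ k)) ^ (1 / p.toReal) := by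
      rw [ENNReal.ofReal_rpow_of_nonneg (by positivity) (by positivity), ← Real.rpow_natCast,
        ← Real.rpow_mul (by norm_num), mul_one_div]
    rw [e, ← ENNReal.mul_rpow_of_nonneg _ _ (by positivity)]
    congr 1
    ring

theorem pieceT_zero {m : ℕ} {η : ℝ → ℝ} (hη : IsBump η) {j k : ℕ}
    (S : SchwartzMap (EuclideanSpace ℝ (Fin m)) ℂ) (hS : ∀ ξ, S ξ = (littlewood η j ξ : ℂ))
    (f : SchwartzMap (EuclideanSpace ℝ (Fin (m+1))) ℂ) (hjk : ¬ k ≤ j + 1) :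
    pieceT S f (lizorkinShell k \ lizorkinAxis k) = 0 := by
  ext x
  rw [pieceT, Pi.zero_apply]
  rw [← integral_zero (EuclideanSpace ℝ (Fin (m+1))) ℂ (μ := volume)]
  congr 1
  ext ξ
  by_cases h : ξ ∈ lizorkinShell (m := m) k \ lizorkinAxis (m := m) k
  · have h1 := (offaxis_norm h).2
    have h2 : (2:ℝ) ^ (j + 1) ≤ 2 ^ (k - 1) := pow_le_pow_right₀ (by norm_num) (by omega)
    rw [modul, hS, littlewood_zero hη (h2.trans h1.le)]
    simp
  · rw [Set.indicator_of_notMem h]; simp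


/-- For `n = m+1 ≥ 2`, `1 < p < ∞`, `0 < q ≤ ∞`, `s < 0` and
`r = min(q,1)`,
`‖Tr f‖_{B^s_{p,q}(ℝ^{n-1})} ≤ C (Σ_k [2^{kr/p} a_k(f)^r + 2^{k(s+1/p)r} b_k(f)^r])^{1/r}`. -/
theorem trace_besov_lizorkin_negative
    (m : ℕ) (hm : 1 ≤ m) (η : ℝ → ℝ) (hη : IsBump η)
    (p q : ℝ≥0∞) (hp : 1 < p) (hp' : p ≠ ∞) (hq : 0 < q) (s : ℝ) (hs : s < 0) (r : ℝ)
    (hr : r = (min q 1).toReal) :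
    ∃ C : ℝ≥0∞, 0 < C ∧ C ≠ ∞ ∧
      ∀ f : SchwartzMap (EuclideanSpace ℝ (Fin (m+1))) ℂ,
        besovNorm η s p q (traceFn (⇑f)) ≤
          C * (∑' k : ℕ,
              (ENNReal.ofReal ((2:ℝ) ^ ((k:ℝ) * r / p.toReal)) * aCoef p k (⇑f) ^ r +
                ENNReal.ofReal ((2:ℝ) ^ ((k:ℝ) * (s + 1 / p.toReal) * r)) *
                  bCoef p k (⇑f) ^ r)) ^ (1/r) := by
  have hr0 : 0 < r := by
    rw [hr]
    exact ENNReal.toReal_pos (lt_min hq one_pos).ne' (ne_of_lt ((min_le_right _ _).trans_lt (by simp)))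
  have hr1 : r ≤ 1 := by
    rw [hr, ← ENNReal.toReal_one]
    exact ENNReal.toReal_mono (by simp) (min_le_right _ _)
  obtain ⟨K, hK, hKb⟩ := pieceT_bound (m := m) hη hp hp'
  set ρ : ℝ≥0∞ := ENNReal.ofReal ((2:ℝ) ^ (s * r)) with hρ
  have hρ0 : ρ ≠ 0 := by
    rw [hρ]; exact (ENNReal.ofReal_pos.2 (by positivity)).ne'
  have hρ1 : ρ < 1 := by
    rw [hρ, ← ENNReal.ofReal_one]
    exact (ENNReal.ofReal_lt_ofReal_iff one_pos).2
      (Real.rpow_lt_one_of_one_lt_of_neg (by norm_num) (mul_neg_of_neg_of_pos hs hr0))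
  have hρt : ρ ≠ ∞ := (hρ1.trans (by simp)).ne
  set G : ℝ≥0∞ := (1 - ρ)⁻¹ with hG
  have hGt : G ≠ ∞ := by
    rw [hG]; exact ENNReal.inv_ne_top.2 (tsub_pos_of_lt hρ1).ne'
  have hGle : G ≤ ρ⁻¹ * G := by
    calc G = 1 * G := (one_mul _).symm
      _ ≤ ρ⁻¹ * G := by gcongr; exact ENNReal.one_le_inv.2 hρ1.le
  set M : ℝ≥0∞ := K ^ r * (ρ⁻¹ * G) with hM
  have hMt : M ≠ ∞ := ENNReal.mul_ne_top (ENNReal.rpow_ne_top_of_nonneg hr0.le hK)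
    (ENNReal.mul_ne_top (ENNReal.inv_ne_top.2 hρ0) hGt)
  refine ⟨M ^ (1/r) + 1, by positivity, ENNReal.add_ne_top.2
    ⟨ENNReal.rpow_ne_top_of_nonneg (by positivity) hMt, by simp⟩, fun f => ?_⟩
  have hσ : ∀ j : ℕ, (ENNReal.ofReal ((2:ℝ) ^ ((j:ℝ) * s))) ^ r = ρ ^ j := by
    intro j
    rw [hρ, ENNReal.ofReal_rpow_of_nonneg (by positivity) hr0.le,
      ← ENNReal.ofReal_pow (by positivity), ← Real.rpow_natCast, ← Real.rpow_mul (by norm_num),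
      ← Real.rpow_mul (by norm_num)]
    congr 2; ring
  set w : ℕ → ℝ≥0∞ := fun k => ENNReal.ofReal ((2:ℝ) ^ ((k:ℝ) / p.toReal)) with hw
  have hw1 : ∀ k : ℕ, ENNReal.ofReal ((2:ℝ) ^ ((k:ℝ) * r / p.toReal)) = w k ^ r := by
    intro k
    rw [hw]
    show _ = (ENNReal.ofReal _) ^ r
    rw [ENNReal.ofReal_rpow_of_nonneg (by positivity) hr0.le, ← Real.rpow_mul (by norm_num)]
    congr 2; ring
  have hw2 : ∀ k : ℕ, ENNReal.ofReal ((2:ℝ) ^ ((k:ℝ) * (s + 1 / p.toReal) * r)) =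
      ρ ^ k * w k ^ r := by
    intro k
    rw [← hw1, ← hσ, ENNReal.ofReal_rpow_of_nonneg (by positivity) hr0.le,
      ← Real.rpow_mul (by norm_num), ← ENNReal.ofReal_mul (by positivity),
      ← Real.rpow_add (by norm_num)]
    congr 2; ring
  simp only [hw1, hw2]
  set a : ℕ → ℝ≥0∞ := fun k => aCoef p k (⇑f) with ha
  set b : ℕ → ℝ≥0∞ := fun k => bCoef p k (⇑f) with hb
  -- bound of one dyadic block
  have hX : ∀ j : ℕ, eLpNorm (dyadicBox η j (traceFn (⇑f))) p volume ≤
      ∑' k, (K * w k * a k + if k ≤ j + 1 then K * w k * b k else 0) := by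
    intro j
    obtain ⟨S, hS, hSb⟩ := hKb j
    have h1 := eLpNorm_hasSum_le (μ := volume) hp.le
      (T := fun k => pieceT S f (lizorkinAxis k) + pieceT S f (lizorkinShell k \ lizorkinAxis k))
      (D := dyadicBox η j (traceFn (⇑f)))
      (fun k => ((pieceT_meas S f (axis_measurable k)).add
        (pieceT_meas S f ((shell_measurable k).diff (axis_measurable k)))).aestronglyMeasurable)
      (fun x => by rw [dyadic_trace j S hS f x]; exact pieceT_hasSum S f x)
    refine h1.trans (ENNReal.tsum_le_tsum fun k => ?_)
    refine (eLpNorm_add_le (pieceT_meas S f (axis_measurable k)).aestronglyMeasurable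
      (pieceT_meas S f ((shell_measurable k).diff (axis_measurable k))).aestronglyMeasurable
      hp.le).trans ?_
    refine add_le_add (hSb k f _ (axis_measurable k) (axis_subset k)) ?_
    split_ifs with hjk
    · exact hSb k f _ ((shell_measurable k).diff (axis_measurable k)) Set.diff_subset
    · rw [pieceT_zero hη S hS f hjk, eLpNorm_zero]
  have hXr : ∀ j : ℕ, (ENNReal.ofReal ((2:ℝ) ^ ((j:ℝ) * s)) *
      eLpNorm (dyadicBox η j (traceFn (⇑f))) p volume) ^ r ≤
      ∑' k, (K ^ r * w k ^ r * a k ^ r * ρ ^ j +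
        K ^ r * w k ^ r * b k ^ r * (if k ≤ j + 1 then ρ ^ j else 0)) := by
    intro j
    rw [ENNReal.mul_rpow_of_nonneg _ _ hr0.le, hσ]
    have h1 := (ENNReal.rpow_le_rpow (hX j) hr0.le).trans (rpow_tsum_le hr0 hr1 _)
    refine (mul_le_mul_right h1 _).trans ?_
    rw [← ENNReal.tsum_mul_left]
    refine ENNReal.tsum_le_tsum fun k => ?_
    refine (mul_le_mul_right (ENNReal.rpow_add_le_add_rpow _ _ hr0.le hr1) _).trans (le_of_eq ?_)
    split_ifs
    · simp only [ENNReal.mul_rpow_of_nonneg _ _ hr0.le]; ring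
    · rw [ENNReal.zero_rpow_of_pos hr0]
      simp only [ENNReal.mul_rpow_of_nonneg _ _ hr0.le]; ring
  have hsum : ∑' j : ℕ, (ENNReal.ofReal ((2:ℝ) ^ ((j:ℝ) * s)) *
      eLpNorm (dyadicBox η j (traceFn (⇑f))) p volume) ^ r ≤
      M * ∑' k, (w k ^ r * a k ^ r + ρ ^ k * w k ^ r * b k ^ r) := by
    refine (ENNReal.tsum_le_tsum hXr).trans ?_
    rw [ENNReal.tsum_comm, ← ENNReal.tsum_mul_left]
    refine ENNReal.tsum_le_tsum fun k => ?_
    rw [ENNReal.tsum_add, ENNReal.tsum_mul_left, ENNReal.tsum_mul_left, ENNReal.tsum_geometric]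
    calc K ^ r * w k ^ r * a k ^ r * (1 - ρ)⁻¹ + K ^ r * w k ^ r * b k ^ r *
          (∑' j : ℕ, if k ≤ j + 1 then ρ ^ j else 0)
        ≤ K ^ r * w k ^ r * a k ^ r * (ρ⁻¹ * G) + K ^ r * w k ^ r * b k ^ r *
          ((ρ⁻¹ * G) * ρ ^ k) := by
          gcongr
          exact tail_tsum' hρ0 hρ1 k
      _ = _ := by rw [hM]; ring
  refine (lqSum_le hq hr _).trans ?_
  refine (ENNReal.rpow_le_rpow hsum (by positivity)).trans ?_
  rw [ENNReal.mul_rpow_of_nonneg _ _ (by positivity)]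
  gcongr
  exact le_self_add
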